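/- Depth formula for Brouwerian algebras: for every n ∈ ℕ, a Brouwerian algebra A satisfies the identity hₙ ≈ ⊤ if and only if there is no strictly increasing chain F₀ ⊊ F₁ ⊊ ⋯ ⊊ Fₙ of n + 1 prime filters of A. -/

import Mathlib

/-!
STATEMENT 7: Depth formula for Brouwerian algebras (= generalized Heyting
algebras): `A` satisfies the identity `hₙ ≈ ⊤` iff there is no strictly
increasing chain of `n + 1` prime filters of `A`.
-/

universe u

/-- The depth terms: `hTerm 0 a = a 0` (the variable `y`) and
`hTerm (n+1) a = a (n+1) ⊔ (a (n+1) ⇨ hTerm n a)`. -/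
def hTerm {α : Type*} [GeneralizedHeytingAlgebra α] : ℕ → (ℕ → α) → α
  | 0, a => a 0
  | n + 1, a => a (n + 1) ⊔ (a (n + 1) ⇨ hTerm n a)

/-- A filter of a lattice: a nonempty upward-closed subset closed under `⊓`. -/
structure IsLatticeFilter {L : Type*} [Lattice L] (F : Set L) : Prop where
  nonempty : F.Nonempty
  mem_of_le : ∀ {x y}, x ∈ F → x ≤ y → y ∈ F
  inf_mem : ∀ {x y}, x ∈ F → y ∈ F → x ⊓ y ∈ F

/-- A prime filter: a proper filter such that `x ⊔ y ∈ F` implies `x ∈ F` or `y ∈ F`. -/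
structure IsPrimeFilter {L : Type*} [Lattice L] (F : Set L) extends
    IsLatticeFilter F : Prop where
  ne_univ : F ≠ Set.univ
  mem_or_mem : ∀ {x y}, x ⊔ y ∈ F → x ∈ F ∨ y ∈ F

/-- The term `hTerm n` only depends on the variables `a 0, …, a n`. -/
theorem hTerm_congr {α : Type*} [GeneralizedHeytingAlgebra α] {a b : ℕ → α} :
    ∀ {n : ℕ}, (∀ i ≤ n, a i = b i) → hTerm n a = hTerm n b
  | 0, h => h 0 le_rfl
  | n + 1, h => by
    rw [hTerm, hTerm, h (n + 1) le_rfl, hTerm_congr fun i hi => h i (hi.trans n.le_succ)]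

theorem IsLatticeFilter.top_mem {L : Type*} [Lattice L] [OrderTop L] {F : Set L}
    (hF : IsLatticeFilter F) : ⊤ ∈ F :=
  let ⟨_, hx⟩ := hF.nonempty
  hF.mem_of_le hx le_top

theorem isLatticeFilter_singleton_top {L : Type*} [Lattice L] [OrderTop L] :
    IsLatticeFilter ({⊤} : Set L) where
  nonempty := Set.singleton_nonempty _
  mem_of_le := by
    rintro x y rfl h
    exact top_le_iff.mp h
  inf_mem := by
    rintro x y rfl rfl
    exact inf_idem _

theorem IsPrimeFilter.compl_of_isPrime {L : Type*} [Lattice L] {J : Order.Ideal L}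
    (hJ : J.IsPrime) : IsPrimeFilter ((J : Set L)ᶜ) where
  nonempty := Set.nonempty_compl.mpr hJ.toIsProper.ne_univ
  mem_of_le hx hxy hy := hx (J.lower hxy hy)
  inf_mem hx hy hxy := (hJ.mem_or_mem hxy).elim hx hy
  ne_univ h := by
    obtain ⟨x, hx⟩ := J.nonempty
    exact (h ▸ Set.mem_univ x : x ∈ (J : Set L)ᶜ) hx
  mem_or_mem {x y} h := by
    by_contra! hxy
    exact h (J.sup_mem (not_not.mp hxy.1) (not_not.mp hxy.2))

/-- The prime filter theorem: a filter omitting `b` extends to a prime filter omitting `b`. -/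
theorem IsLatticeFilter.exists_isPrimeFilter_notMem {L : Type*} [DistribLattice L] {F : Set L}
    (hF : IsLatticeFilter F) {b : L} (hb : b ∉ F) :
    ∃ P : Set L, IsPrimeFilter P ∧ F ⊆ P ∧ b ∉ P := by
  have hPF : Order.IsPFilter F := Order.IsPFilter.of_def hF.nonempty
    (fun x hx y hy => ⟨x ⊓ y, hF.inf_mem hx hy, inf_le_left, inf_le_right⟩)
    (fun hxy hx => hF.mem_of_le hx hxy)
  have hdisj : Disjoint (hPF.toPFilter : Set L) (Order.Ideal.principal b : Set L) :=
    Set.disjoint_left.mpr fun x hx hxb => hb (hF.mem_of_le hx hxb)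
  obtain ⟨J, hJ, hbJ, hFJ⟩ := DistribLattice.prime_ideal_of_disjoint_filter_ideal hdisj
  exact ⟨_, .compl_of_isPrime hJ, Set.disjoint_left.mp hFJ, fun h => h (hbJ le_rfl)⟩

section GeneralizedHeytingAlgebra

variable {A : Type*} [GeneralizedHeytingAlgebra A]

/-- The filter generated by a filter `F` and an element `x` is `{y | x ⇨ y ∈ F}`. -/
theorem IsLatticeFilter.himp_preimage {F : Set A} (hF : IsLatticeFilter F) (x : A) :
    IsLatticeFilter {y | x ⇨ y ∈ F} where
  nonempty := ⟨⊤, by simpa using hF.top_mem⟩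
  mem_of_le hy hyz := hF.mem_of_le hy (himp_le_himp_left hyz)
  inf_mem {y z} hy hz := by
    simpa only [Set.mem_ofPred_eq, himp_inf_distrib] using hF.inf_mem hy hz

/-- If a prime filter omits a value of `hTerm n`, it is the least member of a chain of `n + 1`
prime filters. -/
theorem IsPrimeFilter.exists_strictMono_of_hTerm_notMem (a : ℕ → A) :
    ∀ {n : ℕ} {P : Set A}, IsPrimeFilter P → hTerm n a ∉ P →
      ∃ F : Fin (n + 1) → Set A, (∀ i, IsPrimeFilter (F i)) ∧ StrictMono F ∧ F 0 = P
  | 0, P, hP, _ => ⟨fun _ => P, fun _ => hP, Subsingleton.strictMono (α := Fin 1) _, rfl⟩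
  | n + 1, P, hP, h => by
    have hx : a (n + 1) ∉ P := fun hx => h (hP.mem_of_le hx le_sup_left)
    have hh : hTerm n a ∉ {y | a (n + 1) ⇨ y ∈ P} := fun hh => h (hP.mem_of_le hh le_sup_right)
    obtain ⟨Q, hQ, hPQ, hhQ⟩ :=
      (hP.toIsLatticeFilter.himp_preimage (a (n + 1))).exists_isPrimeFilter_notMem hh
    obtain ⟨F, hF, hmono, rfl⟩ := exists_strictMono_of_hTerm_notMem a hQ hhQ
    have hlt : P < F 0 := by
      refine Set.ssubset_iff_exists.mpr
        ⟨fun y hy => hPQ (hP.mem_of_le hy le_himp), a (n + 1), hPQ ?_, hx⟩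
      simpa using hP.top_mem
    exact ⟨Fin.cons P F, Fin.cases hP hF, strictMono_vecCons.mpr ⟨hlt, hmono⟩, rfl⟩

/-- The least member of a chain of `n + 1` prime filters omits some value of `hTerm n`. -/
theorem exists_hTerm_notMem_of_strictMono :
    ∀ {n : ℕ} {F : Fin (n + 1) → Set A}, (∀ i, IsPrimeFilter (F i)) → StrictMono F →
      ∃ a : ℕ → A, hTerm n a ∉ F 0
  | 0, F, hF, _ =>
    let ⟨y, hy⟩ := (Set.ne_univ_iff_exists_notMem _).mp (hF 0).ne_univ
    ⟨fun _ => y, hy⟩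
  | n + 1, F, hF, hmono => by
    obtain ⟨a, ha⟩ := exists_hTerm_notMem_of_strictMono (F := F ∘ Fin.succ)
      (fun i => hF i.succ) (hmono.comp Fin.strictMono_succ)
    have hlt : F 0 < F (Fin.succ 0) := hmono (Fin.succ_pos 0)
    obtain ⟨hle, x, hx, hx0⟩ := Set.ssubset_iff_exists.mp hlt
    refine ⟨Function.update a (n + 1) x, fun h => ?_⟩
    have hcongr : hTerm n (Function.update a (n + 1) x) = hTerm n a :=
      hTerm_congr fun i hi => Function.update_of_ne (by omega) _ _
    rw [hTerm, hcongr, Function.update_self] at h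
    have himp := hle (((hF 0).mem_or_mem h).resolve_left hx0)
    exact ha ((hF _).mem_of_le ((hF _).inf_mem himp hx) himp_inf_le)

end GeneralizedHeytingAlgebra

theorem brouwerian_depth_formula (n : ℕ) {A : Type u} [GeneralizedHeytingAlgebra A] :
    (∀ a : ℕ → A, hTerm n a = ⊤) ↔
      ¬ ∃ F : Fin (n + 1) → Set A, (∀ i, IsPrimeFilter (F i)) ∧ StrictMono F := by
  constructor
  · rintro h ⟨F, hF, hmono⟩
    obtain ⟨a, ha⟩ := exists_hTerm_notMem_of_strictMono hF hmono
    exact ha (h a ▸ (hF 0).top_mem)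
  · intro h a
    by_contra ha
    obtain ⟨P, hP, -, haP⟩ := isLatticeFilter_singleton_top.exists_isPrimeFilter_notMem ha
    obtain ⟨F, hF, hmono, -⟩ := hP.exists_strictMono_of_hTerm_notMem a haP
    exact h ⟨F, hF, hmono⟩
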